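/- Let 2 < p < ∞. There exists a constant c > 0, depending only on p, such that for every m ≥ 1, every subset A ⊂ ℕ of cardinality m, every nonzero y in the linear span of {h_i^{(p)} : i ∈ A} in L_p[0,1], and every i_0 ∈ A maximizing |F_y(h_i^{(p)})| over i ∈ A, one has inf_{λ ∈ ℝ} ‖y − λ h_{i_0}^{(p)}‖_p ≤ (1 − c·m^{(2−2p)/p})·‖y‖_p. -/

import Mathlib

open MeasureTheory

/-- The Haar functions on `[0,1]` (extended by `0` to all of `ℝ`): `haarFn 0` is the
indicator of `[0,1)` (i.e. `h₀ ≡ 1` on `[0,1]` up to the single point `1`), and for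
`i = 2^n + k` with `0 ≤ k < 2^n` (so that `n = Nat.log 2 i`), `haarFn i` is `1` on
`[k/2^n, (2k+1)/2^(n+1))`, `-1` on `[(2k+1)/2^(n+1), (k+1)/2^n)` and `0` elsewhere. -/
noncomputable def haarFn (i : ℕ) : ℝ → ℝ :=
  if i = 0 then Set.indicator (Set.Ico (0 : ℝ) 1) 1
  else
    let n := Nat.log 2 i
    let k := i - 2 ^ n
    fun t =>
      Set.indicator (Set.Ico ((k : ℝ) / 2 ^ n) ((2 * (k : ℝ) + 1) / 2 ^ (n + 1))) 1 t -
        Set.indicator (Set.Ico ((2 * (k : ℝ) + 1) / 2 ^ (n + 1)) (((k : ℝ) + 1) / 2 ^ n)) 1 t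

/-- The `L_p[0,1]` norm of a function `f : ℝ → ℝ`. -/
noncomputable def pnorm (p : ℝ) (f : ℝ → ℝ) : ℝ :=
  (eLpNorm f (ENNReal.ofReal p) (volume.restrict (Set.Ico (0 : ℝ) 1))).toReal

/-- The `L_p`-normalized Haar function `h_i^{(p)} = h_i / ‖h_i‖_p`. -/
noncomputable def haarFnP (p : ℝ) (i : ℕ) : ℝ → ℝ :=
  fun t => haarFn i t / pnorm p (haarFn i)

/-- The norming functional of a nonzero `y ∈ L_p[0,1]` applied to `g`:
`F_y(g) = ‖y‖_p^{1−p} ∫₀¹ sign(y(t)) |y(t)|^{p−1} g(t) dt`. -/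
noncomputable def normingF (p : ℝ) (y g : ℝ → ℝ) : ℝ :=
  pnorm p y ^ (1 - p) *
    ∫ t in Set.Ico (0 : ℝ) 1, Real.sign (y t) * |y t| ^ (p - 1) * g t

lemma abs_sign_le_one (x : ℝ) : |Real.sign x| ≤ 1 := by
  rcases Real.sign_apply_eq x with h | h | h <;> simp [h]

lemma sign_mul_abs_rpow_mul_self {p : ℝ} (hp : p ≠ 0) (x : ℝ) :
    Real.sign x * |x| ^ (p - 1) * x = |x| ^ p := by
  rcases lt_trichotomy x 0 with hx | rfl | hx
  · rw [Real.sign_of_neg hx, abs_of_neg hx, Real.rpow_sub_one (by linarith)]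
    have := hx.ne
    field_simp
  · simp [hp]
  · rw [Real.sign_of_pos hx, abs_of_pos hx, Real.rpow_sub_one hx.ne']
    field_simp

/-- The convex function `|x|^p` lies above its tangent lines. -/
lemma abs_rpow_tangent_le {p : ℝ} (hp : 1 < p) (a b : ℝ) :
    |b| ^ p + p * (Real.sign b * |b| ^ (p - 1)) * (a - b) ≤ |a| ^ p := by
  have hp0 : 0 < p := by linarith
  have hconj : p.HolderConjugate (p / (p - 1)) := Real.HolderConjugate.conjExponent hp
  have hyoung := Real.young_inequality_of_nonneg (abs_nonneg a)
    (Real.rpow_nonneg (abs_nonneg b) (p - 1)) hconj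
  rw [← Real.rpow_mul (abs_nonneg b), mul_div_cancel₀ p (by linarith : p - 1 ≠ 0)] at hyoung
  have hyoung' : p * (|a| * |b| ^ (p - 1)) ≤ |a| ^ p + (p - 1) * |b| ^ p := by
    calc p * (|a| * |b| ^ (p - 1)) ≤ p * (|a| ^ p / p + |b| ^ p / (p / (p - 1))) := by gcongr
      _ = _ := by field_simp
  have hself := sign_mul_abs_rpow_mul_self hp0.ne' b
  have hcross : Real.sign b * |b| ^ (p - 1) * a ≤ |a| * |b| ^ (p - 1) := by
    have hs := abs_sign_le_one b
    calc Real.sign b * |b| ^ (p - 1) * a ≤ |Real.sign b * |b| ^ (p - 1) * a| := le_abs_self _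
      _ = |Real.sign b| * (|a| * |b| ^ (p - 1)) := by
        rw [abs_mul, abs_mul, abs_of_nonneg (Real.rpow_nonneg (abs_nonneg b) _)]; ring
      _ ≤ 1 * (|a| * |b| ^ (p - 1)) := by gcongr
      _ = _ := one_mul _
  nlinarith [mul_le_mul_of_nonneg_left hcross hp0.le]

/-- On `[0, M]` the function `x^q` has Lipschitz constant `q * M^(q-1)`. -/
lemma rpow_sub_rpow_le {q a b M : ℝ} (hq : 1 < q) (ha : 0 ≤ a) (hab : a ≤ b) (hb : b ≤ M) :
    b ^ q - a ^ q ≤ q * M ^ (q - 1) * (b - a) := by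
  have hb0 : 0 ≤ b := ha.trans hab
  rcases hb0.eq_or_lt with rfl | hbpos
  · obtain rfl : a = 0 := le_antisymm hab ha
    simp
  have h := abs_rpow_tangent_le hq a b
  rw [Real.sign_of_pos hbpos, abs_of_nonneg hb0, abs_of_nonneg ha, one_mul] at h
  have hM : b ^ (q - 1) ≤ M ^ (q - 1) := Real.rpow_le_rpow hb0 hb (by linarith)
  have := mul_le_mul_of_nonneg_right (mul_le_mul_of_nonneg_left hM (by linarith : 0 ≤ q))
    (sub_nonneg.2 hab)
  linarith

/-- On `[-M, M]` the signed power `sign x * |x|^q` has Lipschitz constant `q * M^(q-1)`. -/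
lemma sign_mul_rpow_sub_le {q a b M : ℝ} (hq : 1 < q) (hab : a ≤ b) (ha : |a| ≤ M)
    (hb : |b| ≤ M) :
    Real.sign b * |b| ^ q - Real.sign a * |a| ^ q ≤ q * M ^ (q - 1) * (b - a) := by
  have hsign : ∀ x : ℝ, 0 ≤ x → Real.sign x * |x| ^ q = x ^ q := by
    intro x hx
    rcases hx.eq_or_lt with rfl | hx
    · simp [(by linarith : q ≠ 0)]
    · rw [Real.sign_of_pos hx, abs_of_pos hx, one_mul]
  have hsign' : ∀ x : ℝ, x ≤ 0 → Real.sign x * |x| ^ q = -(-x) ^ q := by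
    intro x hx
    rw [← hsign (-x) (by linarith), Real.sign_neg, abs_neg]; ring
  rcases le_total 0 a with h0a | ha0
  · rw [hsign a h0a, hsign b (h0a.trans hab)]
    exact rpow_sub_rpow_le hq h0a hab ((le_abs_self b).trans hb)
  rcases le_total b 0 with hb0 | h0b
  · rw [hsign' a ha0, hsign' b hb0]
    have := rpow_sub_rpow_le hq (neg_nonneg.2 hb0) (neg_le_neg hab) ((neg_le_abs a).trans ha)
    linarith
  · rw [hsign' a ha0, hsign b h0b]
    have h1 := rpow_sub_rpow_le hq le_rfl h0b ((le_abs_self b).trans hb)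
    have h2 := rpow_sub_rpow_le hq le_rfl (neg_nonneg.2 ha0) ((neg_le_abs a).trans ha)
    rw [Real.zero_rpow (by linarith)] at h1 h2
    linarith

/-- Second-order upper bound for `|x|^p`, `p > 2`, with an explicit constant. -/
lemma abs_sub_mul_rpow_le {p : ℝ} (hp : 2 < p) (u v s : ℝ) (hs : |s| ≤ 1) :
    |u - s * v| ^ p ≤ |u| ^ p - p * s * (Real.sign u * |u| ^ (p - 1) * v) +
      p * (p - 1) * 2 ^ p * s ^ 2 * (|u| ^ p + |v| ^ p) := by
  set w := u - s * v with hw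
  set M := |u| + |v| with hM
  have hM0 : 0 ≤ M := by positivity
  have hsv : |s * v| ≤ |v| := by
    rw [abs_mul]; exact mul_le_of_le_one_left (abs_nonneg v) hs
  have hwM : |w| ≤ M := (abs_sub _ _).trans (by linarith)
  have huM : |u| ≤ M := by linarith [abs_nonneg v]
  have htan := abs_rpow_tangent_le (by linarith : 1 < p) u w
  have hlip : (Real.sign w * |w| ^ (p - 1) - Real.sign u * |u| ^ (p - 1)) * (w - u) ≤
      (p - 1) * M ^ (p - 2) * (w - u) ^ 2 := by
    have hexp : p - 1 - 1 = p - 2 := by ring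
    rcases le_total u w with h | h
    · have := sign_mul_rpow_sub_le (by linarith : 1 < p - 1) h huM hwM
      rw [hexp] at this
      nlinarith [mul_le_mul_of_nonneg_right this (sub_nonneg.2 h)]
    · have := sign_mul_rpow_sub_le (by linarith : 1 < p - 1) h hwM huM
      rw [hexp] at this
      nlinarith [mul_le_mul_of_nonneg_right this (sub_nonneg.2 h)]
  have hpow : M ^ (p - 2) * v ^ 2 ≤ 2 ^ p * (|u| ^ p + |v| ^ p) := by
    have hvM : v ^ 2 ≤ M ^ (2 : ℝ) := by
      rw [Real.rpow_two, ← sq_abs v]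
      gcongr
      linarith [abs_nonneg u]
    have hmax : M ≤ 2 * max |u| |v| := by
      linarith [le_max_left |u| |v|, le_max_right |u| |v|]
    calc M ^ (p - 2) * v ^ 2 ≤ M ^ (p - 2) * M ^ (2 : ℝ) := by gcongr
      _ = M ^ p := by
        rw [← Real.rpow_add_of_nonneg hM0 (by linarith) (by norm_num)]; ring_nf
      _ ≤ (2 * max |u| |v|) ^ p := Real.rpow_le_rpow hM0 hmax (by linarith)
      _ = 2 ^ p * (max |u| |v|) ^ p := Real.mul_rpow (by norm_num) (by positivity)
      _ ≤ 2 ^ p * (|u| ^ p + |v| ^ p) := by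
        gcongr
        have h1 := Real.rpow_nonneg (abs_nonneg u) p
        have h2 := Real.rpow_nonneg (abs_nonneg v) p
        rcases max_choice |u| |v| with h | h <;> rw [h] <;> linarith
  have hwu : w - u = -(s * v) := by rw [hw]; ring
  have hmul := mul_le_mul_of_nonneg_left hpow
    (by have := sq_nonneg s; have : 0 ≤ p * (p - 1) := by nlinarith
        positivity : 0 ≤ p * (p - 1) * s ^ 2)
  have hlip' := mul_le_mul_of_nonneg_left hlip (by linarith : 0 ≤ p)
  rw [hwu] at hlip'
  rw [show u - w = s * v by rw [hw]; ring] at htan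
  nlinarith

/-- A Clarkson-type inequality. -/
lemma two_mul_add_rpow_le_abs_add_rpow {p : ℝ} (hp : 2 ≤ p) (x a : ℝ) :
    2 * (|x| ^ p + |a| ^ p) ≤ |x + a| ^ p + |x - a| ^ p := by
  have hsq : ∀ z : ℝ, |z| ^ p = (z ^ 2) ^ (p / 2) := by
    intro z
    rw [← sq_abs, ← Real.rpow_natCast, ← Real.rpow_mul (abs_nonneg z)]
    congr 1; push_cast; ring
  have hq : 1 ≤ p / 2 := by linarith
  have hconv := (convexOn_rpow hq).2 (Set.mem_Ici.2 (sq_nonneg (x + a)))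
    (Set.mem_Ici.2 (sq_nonneg (x - a))) (by norm_num : (0 : ℝ) ≤ 1 / 2)
    (by norm_num : (0 : ℝ) ≤ 1 / 2) (by norm_num)
  have hsuper := Real.add_rpow_le_rpow_add (sq_nonneg x) (sq_nonneg a) hq
  simp only [smul_eq_mul] at hconv
  rw [show 1 / 2 * (x + a) ^ 2 + 1 / 2 * (x - a) ^ 2 = x ^ 2 + a ^ 2 by ring] at hconv
  rw [hsq, hsq, hsq, hsq]
  linarith

lemma pnorm_nonneg (p : ℝ) (f : ℝ → ℝ) : 0 ≤ pnorm p f := ENNReal.toReal_nonneg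

lemma pnorm_rpow {p : ℝ} (hp : 0 < p) {f : ℝ → ℝ}
    (hf : MemLp f (ENNReal.ofReal p) (volume.restrict (Set.Ico (0 : ℝ) 1))) :
    pnorm p f ^ p = ∫ t in Set.Ico (0 : ℝ) 1, |f t| ^ p := by
  have hint : 0 ≤ ∫ t in Set.Ico (0 : ℝ) 1, |f t| ^ p := integral_nonneg fun t => by positivity
  rw [pnorm, hf.eLpNorm_eq_integral_rpow_norm (by simpa using hp) ENNReal.ofReal_ne_top,
    ENNReal.toReal_ofReal hp.le, ENNReal.toReal_ofReal (by positivity)]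
  simp only [Real.norm_eq_abs]
  exact Real.rpow_inv_rpow hint hp.ne'

lemma integrable_abs_rpow {α : Type*} [MeasurableSpace α] {μ : Measure α} {p : ℝ} (hp : 0 < p)
    {f : α → ℝ} (hf : MemLp f (ENNReal.ofReal p) μ) : Integrable (fun t => |f t| ^ p) μ := by
  have := hf.integrable_norm_rpow (by simpa using hp) ENNReal.ofReal_ne_top
  simpa only [Real.norm_eq_abs, ENNReal.toReal_ofReal hp.le] using this

lemma measurable_sign_mul_abs_rpow (q : ℝ) : Measurable fun x : ℝ => Real.sign x * |x| ^ q := by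
  have hsign : Measurable Real.sign :=
    Measurable.ite measurableSet_Iio measurable_const
      (Measurable.ite measurableSet_Ioi measurable_const measurable_const)
  fun_prop

lemma integrable_sign_mul_abs_rpow_mul {α : Type*} [MeasurableSpace α] {μ : Measure α} {p : ℝ}
    (hp : 1 < p) {f g : α → ℝ} (hf : MemLp f (ENNReal.ofReal p) μ)
    (hg : MemLp g (ENNReal.ofReal p) μ) :
    Integrable (fun t => Real.sign (f t) * |f t| ^ (p - 1) * g t) μ := by
  have hp0 : 0 < p := by linarith
  refine ((integrable_abs_rpow hp0 hf).add (integrable_abs_rpow hp0 hg)).mono' ?_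
    (Filter.Eventually.of_forall fun t => ?_)
  · exact ((measurable_sign_mul_abs_rpow (p - 1)).comp_aemeasurable
      hf.1.aemeasurable).aestronglyMeasurable.mul hg.1
  · set M := max |f t| |g t| with hM
    have hM0 : 0 ≤ M := (abs_nonneg _).trans (le_max_left _ _)
    rw [Real.norm_eq_abs, abs_mul, abs_mul, abs_of_nonneg (Real.rpow_nonneg (abs_nonneg (f t)) _)]
    calc |Real.sign (f t)| * |f t| ^ (p - 1) * |g t| ≤ 1 * M ^ (p - 1) * M := by
          gcongr
          · exact abs_sign_le_one _
          · exact le_max_left _ _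
          · exact le_max_right _ _
      _ = M ^ p := by
        rw [one_mul, ← Real.rpow_add_one' hM0 (by linarith), sub_add_cancel]
      _ ≤ |f t| ^ p + |g t| ^ p := by
        have h1 := Real.rpow_nonneg (abs_nonneg (f t)) p
        have h2 := Real.rpow_nonneg (abs_nonneg (g t)) p
        rcases max_choice |f t| |g t| with h | h <;> rw [hM, h] <;> linarith

/-- The norming functional of `y` in terms of its unnormalized integral. -/
lemma integral_eq_rpow_mul_normingF {p : ℝ} {y : ℝ → ℝ} (hy : 0 < pnorm p y) (g : ℝ → ℝ) :
    ∫ t in Set.Ico (0 : ℝ) 1, Real.sign (y t) * |y t| ^ (p - 1) * g t =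
      pnorm p y ^ (p - 1) * normingF p y g := by
  rw [normingF, ← mul_assoc, ← Real.rpow_add hy]
  simp

/-- Uniform smoothness of power type `2`: a direction on which the norming functional of `y` is at
least `G` admits a step decreasing the norm of `y` by a factor `1 - c * G ^ 2`. -/
lemma exists_pnorm_sub_mul_le {p : ℝ} (hp : 2 < p) {y h : ℝ → ℝ}
    (hy : MemLp y (ENNReal.ofReal p) (volume.restrict (Set.Ico (0 : ℝ) 1)))
    (hh : MemLp h (ENNReal.ofReal p) (volume.restrict (Set.Ico (0 : ℝ) 1)))
    (hh1 : pnorm p h ≤ 1) (hypos : 0 < pnorm p y) {G : ℝ} (hG0 : 0 ≤ G) (hG1 : G ≤ 1)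
    (hG : G ≤ |normingF p y h|) :
    ∃ lam : ℝ, pnorm p (fun t => y t - lam * h t) ≤
      (1 - 1 / (8 * (p - 1) * 2 ^ p) * G ^ 2) * pnorm p y := by
  have hp0 : 0 < p := by linarith
  have hp1 : 0 < p - 1 := by linarith
  set Y := pnorm p y with hY
  set F := normingF p y h with hF
  set c : ℝ := 1 / (8 * (p - 1) * 2 ^ p) with hc
  have h2p : (1 : ℝ) ≤ 2 ^ p := Real.one_le_rpow (by norm_num) hp0.le
  have hc0 : 0 < c := by positivity
  have hKc : p * (p - 1) * 2 ^ p = p / (8 * c) := by rw [hc]; field_simp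
  have hc8 : 8 * c ≤ 1 := by
    rw [hc, ← mul_div_assoc, mul_one, div_le_one (by positivity)]
    nlinarith
  obtain ⟨s, hsF, hs⟩ : ∃ s : ℝ, s * F = 2 * c * G * |F| ∧ |s| ≤ 2 * c * G := by
    refine ⟨Real.sign F * (2 * c * G), ?_, ?_⟩
    · have : Real.sign F * F = |F| := by
        simpa using sign_mul_abs_rpow_mul_self (one_ne_zero : (1 : ℝ) ≠ 0) F
      rw [← this]; ring
    · rw [abs_mul, abs_of_nonneg (by positivity : 0 ≤ 2 * c * G)]
      exact mul_le_of_le_one_left (by positivity) (abs_sign_le_one F)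
  have hs1 : |s| ≤ 1 := hs.trans (by nlinarith)
  have hssq : s ^ 2 ≤ (2 * c * G) ^ 2 := by rw [← sq_abs]; gcongr
  refine ⟨s * Y, ?_⟩
  have hmem : MemLp (fun t => y t - s * Y * h t) (ENNReal.ofReal p)
      (volume.restrict (Set.Ico (0 : ℝ) 1)) := hy.sub (hh.const_mul (s * Y))
  have hcG : c * G ^ 2 ≤ 1 := by nlinarith
  refine (Real.rpow_le_rpow_iff (pnorm_nonneg _ _)
    (mul_nonneg (by linarith) hypos.le) hp0).1 ?_
  rw [pnorm_rpow hp0 hmem, Real.mul_rpow (by linarith) hypos.le]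
  have hiy := integrable_abs_rpow hp0 hy
  have hih := integrable_abs_rpow hp0 hh
  have hix := integrable_sign_mul_abs_rpow_mul (by linarith : 1 < p) hy hh
  have hilin : Integrable (fun t => p * s * Y * (Real.sign (y t) * |y t| ^ (p - 1) * h t))
      (volume.restrict (Set.Ico (0 : ℝ) 1)) := hix.const_mul _
  have hidiff : Integrable
      (fun t => |y t| ^ p - p * s * Y * (Real.sign (y t) * |y t| ^ (p - 1) * h t))
      (volume.restrict (Set.Ico (0 : ℝ) 1)) := hiy.sub hilin
  have hiquad : Integrable
      (fun t => p * (p - 1) * 2 ^ p * s ^ 2 * (|y t| ^ p + Y ^ p * |h t| ^ p))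
      (volume.restrict (Set.Ico (0 : ℝ) 1)) := (hiy.add (hih.const_mul _)).const_mul _
  have hYp : Y ^ (p - 1) * Y = Y ^ p := by
    rw [← Real.rpow_add_one hypos.ne', sub_add_cancel]
  calc ∫ t in Set.Ico (0 : ℝ) 1, |y t - s * Y * h t| ^ p
      ≤ ∫ t in Set.Ico (0 : ℝ) 1, (|y t| ^ p -
          p * s * Y * (Real.sign (y t) * |y t| ^ (p - 1) * h t) +
          p * (p - 1) * 2 ^ p * s ^ 2 * (|y t| ^ p + Y ^ p * |h t| ^ p)) := by
        refine integral_mono (integrable_abs_rpow hp0 hmem)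
          (hidiff.add hiquad) fun t => ?_
        have := abs_sub_mul_rpow_le hp (y t) (Y * h t) s hs1
        rw [abs_mul, abs_of_pos hypos, Real.mul_rpow hypos.le (abs_nonneg _)] at this
        calc |y t - s * Y * h t| ^ p = |y t - s * (Y * h t)| ^ p := by rw [mul_assoc]
          _ ≤ _ := this
          _ = _ := by ring
    _ = Y ^ p - p * s * Y * (Y ^ (p - 1) * F) +
          p * (p - 1) * 2 ^ p * s ^ 2 * (Y ^ p + Y ^ p * pnorm p h ^ p) := by
        rw [integral_add hidiff hiquad, integral_sub hiy hilin, integral_const_mul, integral_const_mul,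
          integral_add hiy (hih.const_mul _), integral_const_mul,
          integral_eq_rpow_mul_normingF hypos, ← pnorm_rpow hp0 hy, ← pnorm_rpow hp0 hh]
    _ ≤ (1 - p * (c * G ^ 2)) * Y ^ p := by
        have hhp : pnorm p h ^ p ≤ 1 := Real.rpow_le_one (pnorm_nonneg _ _) hh1 hp0.le
        have hYp0 : 0 < Y ^ p := Real.rpow_pos_of_pos hypos p
        have hquad : p * (p - 1) * 2 ^ p * s ^ 2 * (1 + pnorm p h ^ p) ≤ p * (c * G ^ 2) := by
          rw [hKc]
          calc p / (8 * c) * s ^ 2 * (1 + pnorm p h ^ p)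
              ≤ p / (8 * c) * (2 * c * G) ^ 2 * (1 + 1) := by
                have := Real.rpow_nonneg (pnorm_nonneg p h) p
                gcongr
            _ = p * (c * G ^ 2) := by field_simp; ring
        have hlin : 2 * (p * (c * G ^ 2)) ≤ p * (s * F) := by
          rw [hsF]
          calc 2 * (p * (c * G ^ 2)) = p * (2 * c * G * G) := by ring
            _ ≤ p * (2 * c * G * |F|) := by gcongr
        calc _ = (1 - p * (s * F) + p * (p - 1) * 2 ^ p * s ^ 2 * (1 + pnorm p h ^ p)) * Y ^ p := by
              rw [← hYp]; ring
          _ ≤ _ := by gcongr; linarith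
    _ ≤ (1 - c * G ^ 2) ^ p * Y ^ p := by
        gcongr
        have := one_add_mul_self_le_rpow_one_add (by linarith : -1 ≤ -(c * G ^ 2))
          (by linarith : 1 ≤ p)
        rw [← sub_eq_add_neg] at this
        linarith

/-- Explicit form of the Haar function with a positive index. -/
lemma exists_haarFn_eq {i : ℕ} (hi : i ≠ 0) :
    ∃ n k : ℕ, k < 2 ^ n ∧ i = 2 ^ n + k ∧ haarFn i = fun t =>
      Set.indicator (Set.Ico ((k : ℝ) / 2 ^ n) ((2 * (k : ℝ) + 1) / 2 ^ (n + 1))) 1 t -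
        Set.indicator (Set.Ico ((2 * (k : ℝ) + 1) / 2 ^ (n + 1)) (((k : ℝ) + 1) / 2 ^ n)) 1 t := by
  have h1 := Nat.pow_log_le_self 2 hi
  have h2 := Nat.lt_pow_succ_log_self (by norm_num : 1 < 2) i
  rw [pow_succ] at h2
  refine ⟨Nat.log 2 i, i - 2 ^ Nat.log 2 i, by omega, by omega, ?_⟩
  simp only [haarFn, if_neg hi]

lemma dyadic_left_lt_mid (k n : ℕ) :
    (k : ℝ) / 2 ^ n < (2 * (k : ℝ) + 1) / 2 ^ (n + 1) := by
  rw [pow_succ, div_lt_div_iff₀ (by positivity) (by positivity)]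
  nlinarith [pow_pos (two_pos : (0 : ℝ) < 2) n]

lemma dyadic_mid_lt_right (k n : ℕ) :
    (2 * (k : ℝ) + 1) / 2 ^ (n + 1) < ((k : ℝ) + 1) / 2 ^ n := by
  rw [pow_succ, div_lt_div_iff₀ (by positivity) (by positivity)]
  nlinarith [pow_pos (two_pos : (0 : ℝ) < 2) n]

lemma dyadic_right_le_one {k n : ℕ} (hk : k < 2 ^ n) : ((k : ℝ) + 1) / 2 ^ n ≤ 1 := by
  rw [div_le_one (by positivity)]
  exact_mod_cast hk

lemma measurable_haarFn (i : ℕ) : Measurable (haarFn i) := by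
  rcases eq_or_ne i 0 with rfl | hi
  · simp only [haarFn, if_true]
    exact measurable_one.indicator measurableSet_Ico
  · obtain ⟨n, k, -, -, h⟩ := exists_haarFn_eq hi
    rw [h]
    exact (measurable_one.indicator measurableSet_Ico).sub
      (measurable_one.indicator measurableSet_Ico)

lemma haarFn_eq_zero_or_one_or_neg_one (i : ℕ) (t : ℝ) :
    haarFn i t = 0 ∨ haarFn i t = 1 ∨ haarFn i t = -1 := by
  rcases eq_or_ne i 0 with rfl | hi
  · simp only [haarFn, if_true, Set.indicator_apply, Pi.one_apply]
    split_ifs <;> simp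
  · obtain ⟨n, k, -, -, h⟩ := exists_haarFn_eq hi
    simp only [h, Set.indicator_apply, Pi.one_apply, Set.mem_Ico]
    split_ifs <;> first | linarith | simp

lemma abs_haarFn_le_one (i : ℕ) (t : ℝ) : |haarFn i t| ≤ 1 := by
  rcases haarFn_eq_zero_or_one_or_neg_one i t with h | h | h <;> simp [h]

lemma integral_indicator_Ico_one {a b : ℝ} (ha : 0 ≤ a) (hab : a ≤ b) (hb : b ≤ 1) :
    ∫ t in Set.Ico (0 : ℝ) 1, Set.indicator (Set.Ico a b) (1 : ℝ → ℝ) t = b - a := by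
  rw [setIntegral_indicator measurableSet_Ico,
    Set.inter_eq_self_of_subset_right (Set.Ico_subset_Ico ha hb)]
  simp [hab]

lemma integrable_indicator_Ico_one (a b : ℝ) :
    Integrable (Set.indicator (Set.Ico a b) (1 : ℝ → ℝ))
      (volume.restrict (Set.Ico (0 : ℝ) 1)) :=
  (integrable_const (1 : ℝ)).indicator measurableSet_Ico

lemma integral_haarFn {i : ℕ} (hi : i ≠ 0) : ∫ t in Set.Ico (0 : ℝ) 1, haarFn i t = 0 := by
  obtain ⟨n, k, hk, -, h⟩ := exists_haarFn_eq hi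
  have h1 := dyadic_left_lt_mid k n
  have h2 := dyadic_mid_lt_right k n
  have h3 := dyadic_right_le_one hk
  have h0 : (0 : ℝ) ≤ (k : ℝ) / 2 ^ n := by positivity
  rw [h, integral_sub (integrable_indicator_Ico_one _ _) (integrable_indicator_Ico_one _ _),
    integral_indicator_Ico_one h0 h1.le (by linarith),
    integral_indicator_Ico_one (by linarith) h2.le h3]
  field_simp
  ring

/-- A dyadic point of level at most `n` does not separate the points of a dyadic interval of
level `n`. -/
lemma dyadic_le_iff {n l k : ℕ} (j : ℕ) (hl : l ≤ n) {t : ℝ}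
    (ht : t ∈ Set.Ico ((k : ℝ) / 2 ^ n) (((k : ℝ) + 1) / 2 ^ n)) :
    (j : ℝ) / 2 ^ l ≤ t ↔ j * 2 ^ (n - l) ≤ k := by
  have hj : (j : ℝ) / 2 ^ l = ((j * 2 ^ (n - l) : ℕ) : ℝ) / 2 ^ n := by
    rw [← Nat.sub_add_cancel hl, Nat.add_sub_cancel, pow_add]
    push_cast
    field_simp
  rw [hj]
  constructor
  · intro h
    have h' := h.trans_lt ht.2
    rw [div_lt_div_iff_of_pos_right (by positivity)] at h'
    exact Nat.lt_succ_iff.1 (by exact_mod_cast h')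
  · intro h
    refine le_trans ?_ ht.1
    gcongr

lemma mem_dyadic_of_haarFn_ne_zero {n k : ℕ} {t : ℝ}
    (ht : Set.indicator (Set.Ico ((k : ℝ) / 2 ^ n) ((2 * (k : ℝ) + 1) / 2 ^ (n + 1)))
        (1 : ℝ → ℝ) t -
      Set.indicator (Set.Ico ((2 * (k : ℝ) + 1) / 2 ^ (n + 1)) (((k : ℝ) + 1) / 2 ^ n))
        (1 : ℝ → ℝ) t ≠ 0) :
    t ∈ Set.Ico ((k : ℝ) / 2 ^ n) (((k : ℝ) + 1) / 2 ^ n) := by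
  have h1 := dyadic_left_lt_mid k n
  have h2 := dyadic_mid_lt_right k n
  by_contra hmem
  refine ht ?_
  rw [Set.indicator_of_notMem, Set.indicator_of_notMem, sub_zero]
  · exact fun h => hmem ⟨h1.le.trans h.1, h.2⟩
  · exact fun h => hmem ⟨h.1, h.2.trans h2⟩

/-- A Haar function is constant on the support of any later one. -/
lemma haarFn_eq_of_ne_zero {i j : ℕ} (hij : i < j) {s t : ℝ} (hs : haarFn j s ≠ 0)
    (ht : haarFn j t ≠ 0) : haarFn i s = haarFn i t := by
  obtain ⟨n, k, hk, hj, hfun⟩ := exists_haarFn_eq (by omega : j ≠ 0)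
  rw [hfun] at hs ht
  replace hs := mem_dyadic_of_haarFn_ne_zero hs
  replace ht := mem_dyadic_of_haarFn_ne_zero ht
  have hend : ∀ a l : ℕ, l ≤ n → ((a : ℝ) / 2 ^ l ≤ s ↔ (a : ℝ) / 2 ^ l ≤ t) :=
    fun a l hl => (dyadic_le_iff a hl hs).trans (dyadic_le_iff a hl ht).symm
  have hmem : ∀ a b l l' : ℕ, l ≤ n → l' ≤ n →
      (s ∈ Set.Ico ((a : ℝ) / 2 ^ l) ((b : ℝ) / 2 ^ l') ↔
        t ∈ Set.Ico ((a : ℝ) / 2 ^ l) ((b : ℝ) / 2 ^ l')) := by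
    intro a b l l' hl hl'
    simp only [Set.mem_Ico, hend a l hl, ← not_le, hend b l' hl']
  rcases eq_or_ne i 0 with rfl | hi
  · have := hmem 0 1 0 0 (by omega) (by omega)
    norm_num at this
    simp only [haarFn, if_true, Set.indicator_apply, Set.mem_Ico, this, Pi.one_apply]
  obtain ⟨n', k', hk', hi', hfun'⟩ := exists_haarFn_eq hi
  have hn : n' ≤ n := by
    by_contra! h
    have := Nat.pow_le_pow_right (by norm_num : 0 < 2) h
    rw [Nat.pow_succ] at this
    omega
  rcases hn.lt_or_eq with hn | rfl
  · have h1 := hmem k' (2 * k' + 1) n' (n' + 1) (by omega) (by omega)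
    have h2 := hmem (2 * k' + 1) (k' + 1) (n' + 1) n' (by omega) (by omega)
    push_cast at h1 h2
    simp only [hfun', Set.indicator_apply, h1, h2, Pi.one_apply]
  · have hkk : ((k' : ℝ) + 1) / 2 ^ n' ≤ (k : ℝ) / 2 ^ n' := by
      gcongr
      exact_mod_cast (by omega : k' + 1 ≤ k)
    have hzero : ∀ r ∈ Set.Ico ((k : ℝ) / 2 ^ n') (((k : ℝ) + 1) / 2 ^ n'), haarFn i r = 0 := by
      intro r hr
      rw [hfun']
      by_contra hne
      have := mem_dyadic_of_haarFn_ne_zero hne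
      exact absurd (hr.1.trans_lt this.2) (not_lt.2 hkk)
    rw [hzero s hs, hzero t ht]

lemma memLp_sum_haarFn (q : ENNReal) (A : Finset ℕ) (a : ℕ → ℝ) :
    MemLp (fun t => ∑ i ∈ A, a i * haarFn i t) q (volume.restrict (Set.Ico (0 : ℝ) 1)) :=
  memLp_finsetSum _ fun i _ =>
    (MemLp.of_bound (measurable_haarFn i).aestronglyMeasurable 1
      (Filter.Eventually.of_forall (abs_haarFn_le_one i))).const_mul (a i)

lemma memLp_haarFn (q : ENNReal) (i : ℕ) :
    MemLp (haarFn i) q (volume.restrict (Set.Ico (0 : ℝ) 1)) := by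
  simpa using memLp_sum_haarFn q {i} 1

lemma memLp_haarFnP (p : ℝ) (q : ENNReal) (i : ℕ) :
    MemLp (haarFnP p i) q (volume.restrict (Set.Ico (0 : ℝ) 1)) := by
  have hfun : haarFnP p i = fun t => (pnorm p (haarFn i))⁻¹ * haarFn i t := by
    ext t
    rw [haarFnP, div_eq_inv_mul]
  rw [hfun]
  exact (memLp_haarFn q i).const_mul _

lemma pnorm_haarFn_pos {p : ℝ} (hp : 0 < p) (i : ℕ) : 0 < pnorm p (haarFn i) := by
  obtain ⟨a, b, ha, hab, hb, hone⟩ : ∃ a b : ℝ, 0 ≤ a ∧ a < b ∧ b ≤ 1 ∧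
      ∀ t ∈ Set.Ico a b, haarFn i t = 1 := by
    rcases eq_or_ne i 0 with rfl | hi
    · refine ⟨0, 1, le_rfl, one_pos, le_rfl, fun t ht => ?_⟩
      simp only [haarFn, if_true, Set.indicator_of_mem ht, Pi.one_apply]
    · obtain ⟨n, k, hk, -, h⟩ := exists_haarFn_eq hi
      refine ⟨_, _, by positivity, dyadic_left_lt_mid k n,
        (dyadic_mid_lt_right k n).le.trans (dyadic_right_le_one hk), fun t ht => ?_⟩
      simp only [h]
      rw [Set.indicator_of_mem ht, Set.indicator_of_notMem fun h' => absurd h'.1 (not_le.2 ht.2)]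
      simp
  have hpow : 0 < pnorm p (haarFn i) ^ p := by
    rw [pnorm_rpow hp (memLp_haarFn _ i)]
    calc 0 < b - a := sub_pos.2 hab
      _ = ∫ t in Set.Ico (0 : ℝ) 1, Set.indicator (Set.Ico a b) (1 : ℝ → ℝ) t :=
        (integral_indicator_Ico_one ha hab.le hb).symm
      _ ≤ _ := by
        refine integral_mono (integrable_indicator_Ico_one a b)
          (integrable_abs_rpow hp (memLp_haarFn _ i)) fun t => ?_
        refine Set.indicator_apply_le' (fun ht => ?_) (fun _ => by positivity)
        simp [hone t ht]
  refine (pnorm_nonneg p _).lt_of_ne fun h => ?_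
  rw [← h, Real.zero_rpow hp.ne'] at hpow
  exact lt_irrefl _ hpow

lemma pnorm_haarFnP {p : ℝ} (hp : 0 < p) (i : ℕ) : pnorm p (haarFnP p i) = 1 := by
  have hpos := pnorm_haarFn_pos hp i
  have hfun : haarFnP p i = (pnorm p (haarFn i))⁻¹ • haarFn i := by
    ext t
    simp [haarFnP, div_eq_inv_mul]
  rw [hfun, pnorm, eLpNorm_const_smul, ENNReal.toReal_mul, ← pnorm]
  simp [abs_of_pos hpos, hpos.ne']

/-- Adding a mean-zero `{-1, 0, 1}`-valued function on whose support `f` is constant increases the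
`p`-th moment by at least its own `p`-th moment. -/
lemma integral_abs_rpow_add_le {α : Type*} [MeasurableSpace α] {μ : Measure α} {p : ℝ}
    (hp : 2 ≤ p) {f h : α → ℝ} (hf : MemLp f (ENNReal.ofReal p) μ)
    (hh : MemLp h (ENNReal.ofReal p) μ) (hval : ∀ t, h t = 0 ∨ h t = 1 ∨ h t = -1)
    (hmean : ∫ t, h t ∂μ = 0) (hconst : ∀ s t, h s ≠ 0 → h t ≠ 0 → f s = f t) (a : ℝ) :
    (∫ t, |f t| ^ p ∂μ) + ∫ t, |a * h t| ^ p ∂μ ≤ ∫ t, |f t + a * h t| ^ p ∂μ := by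
  have hp0 : 0 < p := by linarith
  have hif := integrable_abs_rpow hp0 hf
  have hih := integrable_abs_rpow hp0 (hh.const_mul a)
  have hadd := integrable_abs_rpow hp0 (hf.add (hh.const_mul a))
  have hsub := integrable_abs_rpow hp0 (hf.sub (hh.const_mul a))
  simp only [Pi.add_apply, Pi.sub_apply] at hadd hsub
  obtain ⟨K, hK⟩ : ∃ K : ℝ, ∀ t, |f t + a * h t| ^ p - |f t - a * h t| ^ p = K * h t := by
    by_cases hex : ∃ s, h s ≠ 0
    · obtain ⟨s, hs⟩ := hex
      refine ⟨|f s + a| ^ p - |f s - a| ^ p, fun t => ?_⟩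
      by_cases ht : h t = 0
      · simp [ht]
      · rw [hconst s t hs ht]
        rcases hval t with h' | h' | h'
        · exact absurd h' ht
        · simp [h']
        · simp [h', ← sub_eq_add_neg]
    · push Not at hex
      exact ⟨0, fun t => by simp [hex t]⟩
  have hsymm : ∫ t, |f t + a * h t| ^ p ∂μ = ∫ t, |f t - a * h t| ^ p ∂μ := by
    rw [← sub_eq_zero, ← integral_sub hadd hsub]
    simp only [hK, integral_const_mul, hmean, mul_zero]
  have hle : ∫ t, 2 * (|f t| ^ p + |a * h t| ^ p) ∂μ ≤
      ∫ t, (|f t + a * h t| ^ p + |f t - a * h t| ^ p) ∂μ :=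
    integral_mono ((hif.add hih).const_mul 2) (hadd.add hsub) fun t =>
      two_mul_add_rpow_le_abs_add_rpow hp (f t) (a * h t)
  rw [integral_const_mul, integral_add hif hih, integral_add hadd hsub, ← hsymm] at hle
  linarith

/-- Lower `p`-estimate for the Haar system. -/
lemma sum_integral_abs_rpow_le {p : ℝ} (hp : 2 ≤ p) (A : Finset ℕ) (a : ℕ → ℝ) :
    ∑ i ∈ A, ∫ t in Set.Ico (0 : ℝ) 1, |a i * haarFn i t| ^ p ≤
      ∫ t in Set.Ico (0 : ℝ) 1, |∑ i ∈ A, a i * haarFn i t| ^ p := by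
  induction A using Finset.induction_on_max with
  | empty => simp [(by linarith : p ≠ 0)]
  | insert n s hlt ih =>
    have hn : n ∉ s := fun h => lt_irrefl _ (hlt n h)
    simp only [Finset.sum_insert hn]
    rcases s.eq_empty_or_nonempty with rfl | ⟨j, hj⟩
    · simp
    have hn0 : n ≠ 0 := by have := hlt j hj; omega
    have hstep := integral_abs_rpow_add_le hp (memLp_sum_haarFn _ s a) (memLp_haarFn _ n)
      (haarFn_eq_zero_or_one_or_neg_one n) (integral_haarFn hn0)
      (fun x y hx hy => Finset.sum_congr rfl fun i hi => by
        rw [haarFn_eq_of_ne_zero (hlt i hi) hx hy]) (a n)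
    simp only [add_comm (a n * haarFn n _)]
    linarith

lemma sum_abs_rpow_le_pnorm_rpow {p : ℝ} (hp : 2 ≤ p) (A : Finset ℕ) (b : ℕ → ℝ) :
    ∑ i ∈ A, |b i| ^ p ≤ pnorm p (fun t => ∑ i ∈ A, b i * haarFnP p i t) ^ p := by
  have hp0 : 0 < p := by linarith
  have hmem : MemLp (fun t => ∑ i ∈ A, b i * haarFnP p i t) (ENNReal.ofReal p)
      (volume.restrict (Set.Ico (0 : ℝ) 1)) :=
    memLp_finsetSum _ fun i _ => (memLp_haarFnP p _ i).const_mul (b i)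
  have hcoef : ∀ i t, b i * haarFnP p i t = b i / pnorm p (haarFn i) * haarFn i t := by
    intro i t
    rw [haarFnP]; ring
  rw [pnorm_rpow hp0 hmem]
  simp only [hcoef]
  refine le_trans (le_of_eq ?_) (sum_integral_abs_rpow_le hp A _)
  refine Finset.sum_congr rfl fun i _ => ?_
  simp only [← hcoef, abs_mul, Real.mul_rpow (abs_nonneg _) (abs_nonneg _)]
  rw [integral_const_mul, ← pnorm_rpow hp0 (memLp_haarFnP p _ i), pnorm_haarFnP hp0]
  simp

/-- The norming functional is large on at least one Haar function occurring in `y`. -/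
lemma card_rpow_le_of_normingF_le {p : ℝ} (hp : 2 ≤ p) {A : Finset ℕ} {b : ℕ → ℝ} {y : ℝ → ℝ}
    (hy : y = fun t => ∑ i ∈ A, b i * haarFnP p i t) (hypos : 0 < pnorm p y) (hA : 0 < A.card)
    {M : ℝ} (hM0 : 0 ≤ M) (hM : ∀ i ∈ A, |normingF p y (haarFnP p i)| ≤ M) :
    (A.card : ℝ) ^ ((1 - p) / p) ≤ M := by
  have hp0 : 0 < p := by linarith
  have hmem : MemLp y (ENNReal.ofReal p) (volume.restrict (Set.Ico (0 : ℝ) 1)) := by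
    rw [hy]
    exact memLp_finsetSum _ fun i _ => (memLp_haarFnP p _ i).const_mul (b i)
  set Y := pnorm p y with hY
  have hYq : 0 < Y ^ (p - 1) := Real.rpow_pos_of_pos hypos _
  have hYF : Y = ∑ i ∈ A, b i * normingF p y (haarFnP p i) := by
    refine mul_left_cancel₀ hYq.ne' ?_
    rw [← Real.rpow_add_one hypos.ne', sub_add_cancel, hY, pnorm_rpow hp0 hmem, ← hY,
      Finset.mul_sum]
    have hterm : ∀ i, Y ^ (p - 1) * (b i * normingF p y (haarFnP p i)) =
        ∫ t in Set.Ico (0 : ℝ) 1,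
          b i * (Real.sign (y t) * |y t| ^ (p - 1) * haarFnP p i t) := by
      intro i
      rw [integral_const_mul, integral_eq_rpow_mul_normingF hypos]
      ring
    simp only [hterm]
    rw [← integral_finsetSum _ fun i _ => (integrable_sign_mul_abs_rpow_mul (by linarith) hmem
      (memLp_haarFnP p _ i)).const_mul (b i)]
    refine integral_congr_ae (Filter.Eventually.of_forall fun t => ?_)
    have hyt : y t = ∑ i ∈ A, b i * haarFnP p i t := congrFun hy t
    calc |y t| ^ p = Real.sign (y t) * |y t| ^ (p - 1) * y t :=
          (sign_mul_abs_rpow_mul_self hp0.ne' (y t)).symm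
      _ = Real.sign (y t) * |y t| ^ (p - 1) * ∑ i ∈ A, b i * haarFnP p i t := by
          rw [← hyt]
      _ = _ := by
          rw [Finset.mul_sum]
          exact Finset.sum_congr rfl fun i _ => by ring
  have hYle : Y ≤ M * ∑ i ∈ A, |b i| := by
    rw [hYF, Finset.mul_sum]
    refine Finset.sum_le_sum fun i hi => (le_abs_self _).trans ?_
    rw [abs_mul, mul_comm]
    gcongr
    exact hM i hi
  have hYpow : Y ^ p ≤ M ^ p * ((A.card : ℝ) ^ (p - 1) * Y ^ p) := by
    calc Y ^ p ≤ (M * ∑ i ∈ A, |b i|) ^ p := by gcongr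
      _ = M ^ p * (∑ i ∈ A, |b i|) ^ p := Real.mul_rpow hM0 (by positivity)
      _ ≤ M ^ p * ((A.card : ℝ) ^ (p - 1) * ∑ i ∈ A, |b i| ^ p) := by
        gcongr
        exact Real.rpow_sum_le_const_mul_sum_rpow A b (by linarith)
      _ ≤ _ := by
        gcongr
        rw [hY, hy]
        exact sum_abs_rpow_le_pnorm_rpow hp A b
  have hcard : (0 : ℝ) < A.card := by exact_mod_cast hA
  have hone : 1 ≤ M ^ p * (A.card : ℝ) ^ (p - 1) := by
    have hYp := Real.rpow_pos_of_pos hypos p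
    rw [← mul_assoc] at hYpow
    exact (le_mul_iff_one_le_left hYp).1 hYpow
  refine (Real.rpow_le_rpow_iff (by positivity) hM0 hp0).1 ?_
  rw [← Real.rpow_mul hcard.le, div_mul_cancel₀ _ hp0.ne', show 1 - p = -(p - 1) by ring,
    Real.rpow_neg hcard.le, inv_le_iff_one_le_mul₀ (by positivity)]
  exact hone

/-- for `2 < p < ∞` there is `c = c(p) > 0` such that for every
`m`-element set `A ⊂ ℕ`, every nonzero `y` in the span of `{h_i^{(p)} : i ∈ A}`
and every `i₀ ∈ A` maximizing `|F_y(h_i^{(p)})|`, the DGA greedy step satisfies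
`inf_λ ‖y − λ h_{i₀}^{(p)}‖_p ≤ (1 − c·m^{(2−2p)/p})·‖y‖_p`. -/
theorem stmt_15 (p : ℝ) (hp : 2 < p) :
    ∃ c : ℝ, 0 < c ∧
      ∀ (m : ℕ), 1 ≤ m → ∀ A : Finset ℕ, A.card = m →
        ∀ (b : ℕ → ℝ) (y : ℝ → ℝ),
          y = (fun t => ∑ i ∈ A, b i * haarFnP p i t) → y ≠ 0 →
          ∀ i₀ ∈ A,
            (∀ i ∈ A, |normingF p y (haarFnP p i)| ≤ |normingF p y (haarFnP p i₀)|) →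
            (⨅ lam : ℝ, pnorm p (fun t => y t - lam * haarFnP p i₀ t)) ≤
              (1 - c * (m : ℝ) ^ ((2 - 2 * p) / p)) * pnorm p y := by
  have hp0 : 0 < p := by linarith
  have hp1 : 0 < p - 1 := by linarith
  refine ⟨1 / (8 * (p - 1) * 2 ^ p), by positivity, ?_⟩
  rintro m hm A rfl b y hy - i₀ hi₀ hmax
  have hbdd : BddBelow (Set.range fun lam : ℝ => pnorm p fun t => y t - lam * haarFnP p i₀ t) :=
    ⟨0, by rintro _ ⟨lam, rfl⟩; exact pnorm_nonneg _ _⟩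
  rcases (pnorm_nonneg p y).eq_or_lt with h0 | hypos
  · rw [← h0, mul_zero]
    refine (ciInf_le hbdd 0).trans ?_
    simp [← h0]
  have hmem : MemLp y (ENNReal.ofReal p) (volume.restrict (Set.Ico (0 : ℝ) 1)) := by
    rw [hy]
    exact memLp_finsetSum _ fun i _ => (memLp_haarFnP p _ i).const_mul (b i)
  have hcard : (1 : ℝ) ≤ A.card := by exact_mod_cast hm
  have hG := card_rpow_le_of_normingF_le hp.le hy hypos hm (abs_nonneg _) hmax
  have hG1 : (A.card : ℝ) ^ ((1 - p) / p) ≤ 1 :=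
    Real.rpow_le_one_of_one_le_of_nonpos hcard (div_nonpos_of_nonpos_of_nonneg (by linarith) hp0.le)
  obtain ⟨lam, hlam⟩ := exists_pnorm_sub_mul_le hp hmem (memLp_haarFnP p _ i₀)
    (pnorm_haarFnP hp0 i₀).le hypos (by positivity) hG1 hG
  have hsq : ((A.card : ℝ) ^ ((1 - p) / p)) ^ 2 = (A.card : ℝ) ^ ((2 - 2 * p) / p) := by
    rw [← Real.rpow_natCast, ← Real.rpow_mul (by linarith)]
    congr 1
    push_cast
    ring
  rw [hsq] at hlam
  exact (ciInf_le hbdd lam).trans hlam
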